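/- arXiv:2604.12692 — 4 statements merged into one kernel-verified Lean document; each statement's English description precedes it below -/
import Mathlib

section
/- There exists an absolute constant C₀ > 0 with the following property. Let x₁,…,x_n be linearly independent vectors in ℝⁿ and set δ₀ = (max_{1≤j≤n} |x_j|)⁻¹. Let B ⊂ ℝⁿ be a centrally symmetric convex body with r·B₂ⁿ ⊆ B for some r > 0, and define 𝒜 = {R ∈ M_n(ℝ) : R(x_i) ∈ B for i = 1,…,n}. Then for every 0 < t ≤ r·δ₀ and every subset 𝒜₀ ⊆ 𝒜 there exists a t-net 𝒩_t ⊆ 𝒜₀ of 𝒜₀ with respect to the ℓ₂ⁿ → ℓ₂ⁿ operator norm such that |𝒩_t| ≤ (C₀/t)^{n²} · ( vol_n(B)·vol_n(B₁ⁿ) / ( vol_n(B₂ⁿ)·vol_n(absconv{x₁,…,x_n}) ) )ⁿ. -/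
open MeasureTheory Set
open scoped ENNReal RealInnerProductSpace Pointwise BigOperators

noncomputable section

abbrev Euc (n : ℕ) := EuclideanSpace ℝ (Fin n)

/-- The absolute convex hull of a set. -/
def absConv (n : ℕ) (A : Set (Euc n)) : Set (Euc n) := convexHull ℝ (A ∪ -A)

/-- A log-concave function on `ℝⁿ`. -/
def IsLogConcaveFn (n : ℕ) (f : Euc n → ℝ) : Prop :=
  ∀ x y : Euc n, ∀ a b : ℝ, 0 ≤ a → 0 ≤ b → a + b = 1 →
    f x ^ a * f y ^ b ≤ f (a • x + b • y)

/-- `f` is a log-concave density of `μ` with barycenter `0`, total mass `1`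
and identity covariance. -/
def IsIsotropicDensity (n : ℕ) (μ : Measure (Euc n)) (f : Euc n → ℝ) : Prop :=
  (∀ x, 0 ≤ f x) ∧ IsLogConcaveFn n f ∧
  μ = volume.withDensity (fun x => ENNReal.ofReal (f x)) ∧
  IsProbabilityMeasure μ ∧ (∫ x, x ∂μ) = 0 ∧
  ∀ y z : Euc n, (∫ x, ⟪x, y⟫ * ⟪x, z⟫ ∂μ) = ⟪y, z⟫

/-- An isotropic log-concave probability measure on `ℝⁿ`. -/
def IsIsotropicLogConcave (n : ℕ) (μ : Measure (Euc n)) : Prop :=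
  ∃ f, IsIsotropicDensity n μ f

/-- A centrally symmetric convex body. -/
def IsSymmConvexBody (n : ℕ) (K : Set (Euc n)) : Prop :=
  Convex ℝ K ∧ K = -K ∧ IsCompact K ∧ (0 : Euc n) ∈ interior K

/-- A convex body (not necessarily symmetric). -/
def IsConvexBody (n : ℕ) (K : Set (Euc n)) : Prop :=
  Convex ℝ K ∧ IsCompact K ∧ (interior K).Nonempty

/-- The operator norm of `T : X_K → X_L`, where `X_K` and `X_L` carry the gauges of `K`, `L`. -/
def bodyOpNorm (n : ℕ) (K L : Set (Euc n)) (T : Euc n →ₗ[ℝ] Euc n) : ℝ :=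
  sSup ((fun x => gauge L (T x)) '' K)

/-- The Banach–Mazur distance between the normed spaces with unit balls `K` and `L`. -/
def distBM (n : ℕ) (K L : Set (Euc n)) : ℝ :=
  sInf {d : ℝ | ∃ T : Euc n ≃ₗ[ℝ] Euc n,
    d = bodyOpNorm n K L T.toLinearMap * bodyOpNorm n L K T.symm.toLinearMap}

/-- The `ℓ₂ⁿ → ℓ₂ⁿ` operator norm of a linear map. -/
def eucOpNorm (n : ℕ) (T : Euc n →ₗ[ℝ] Euc n) : ℝ :=
  ‖LinearMap.toContinuousLinearMap T‖

/-- The standard orthonormal basis vectors of `ℝⁿ`, as a set. -/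
def stdBasisSet (n : ℕ) : Set (Euc n) :=
  Set.range fun i : Fin n => (EuclideanSpace.single i (1 : ℝ) : Euc n)

/-- The basis-enriched random polytope `absconv{e₁,…,eₙ, x₁/√n,…,x_m/√n}`. -/
def enrichedBody (n m : ℕ) (x : Fin m → Euc n) : Set (Euc n) :=
  absConv n (stdBasisSet n ∪ Set.range fun j => (Real.sqrt n)⁻¹ • x j)

/-- `s_k(T) ≥ 1`, via the Courant–Fischer characterization of singular values. -/
def SingValGe (n : ℕ) (T : Euc n →ₗ[ℝ] Euc n) (k : ℕ) : Prop :=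
  ∃ F : Submodule ℝ (Euc n), k ≤ Module.finrank ℝ F ∧ ∀ x ∈ F, ‖x‖ ≤ ‖T x‖

/-- A `(k,β)`-mixing operator. -/
def IsMixing (n : ℕ) (T : Euc n →ₗ[ℝ] Euc n) (k : ℕ) (β : ℝ) : Prop :=
  ∃ E : Submodule ℝ (Euc n), k ≤ Module.finrank ℝ E ∧
    ∀ x ∈ E, β * ‖x‖ ≤ ‖Submodule.orthogonalProjectionOnto Eᗮ (T x)‖

/-- The basis constant of the normed space with unit ball `K`. -/
def basisConstant (n : ℕ) (K : Set (Euc n)) : ℝ :=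
  sInf {c : ℝ | 0 < c ∧ ∃ b : Module.Basis (Fin n) ℝ (Euc n),
    ∀ k : ℕ, k ≤ n → ∀ lam : Fin n → ℝ,
      gauge K (∑ i ∈ Finset.univ.filter (fun i : Fin n => (i : ℕ) < k), lam i • b i) ≤
        c * gauge K (∑ i, lam i • b i)}

/-- The polar body. -/
def polarBody (n : ℕ) (B : Set (Euc n)) : Set (Euc n) :=
  {y | ∀ x ∈ B, ⟪x, y⟫ ≤ 1}

/-- The 1-summing norm of the identity `I : X_B* → ℓ₂ⁿ`. -/
def piOneId (n : ℕ) (B : Set (Euc n)) : ℝ :=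
  sInf {α : ℝ | 0 < α ∧ ∀ N : ℕ, ∀ z : Fin N → Euc n,
    ∑ j, ‖z j‖ ≤ α * sSup ((fun y => ∑ j, |⟪y, z j⟫|) '' B)}

/-- The normed space with unit ball `L` admits a `1`-unconditional basis. -/
def HasOneUncondBasis (n : ℕ) (L : Set (Euc n)) : Prop :=
  ∃ b : Module.Basis (Fin n) ℝ (Euc n), ∀ lam : Fin n → ℝ,
    gauge L (∑ i, lam i • b i) = gauge L (∑ i, |lam i| • b i)

theorem aux_pack {V : Type*} [NormedAddCommGroup V] [NormedSpace ℝ V] [FiniteDimensional ℝ V]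
    [MeasurableSpace V] [BorelSpace V] (μ : Measure V) [μ.IsAddHaarMeasure]
    (A : Set V) (hA : Convex ℝ A) (hAf : μ A ≠ ⊤) (t : ℝ) (ht : 0 < t)
    (hball : Metric.ball (0 : V) t ⊆ A) (A₀ : Set V) (hA₀ : A₀ ⊆ A) :
    ∃ N : Finset V, ↑N ⊆ A₀ ∧ (∀ a ∈ A₀, ∃ s ∈ N, ‖a - s‖ ≤ t) ∧
      (N.card : ℝ≥0∞) * (ENNReal.ofReal (t ^ Module.finrank ℝ V) * μ (Metric.ball 0 1)) ≤
        ENNReal.ofReal (3 ^ Module.finrank ℝ V) * μ A := by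
  set d := Module.finrank ℝ V with hd
  have key : ∀ N : Finset V, ↑N ⊆ A₀ → (∀ a ∈ N, ∀ b ∈ N, a ≠ b → t < ‖a - b‖) →
      (N.card : ℝ≥0∞) * (ENNReal.ofReal (t ^ d) * μ (Metric.ball 0 1)) ≤
        ENNReal.ofReal (3 ^ d) * μ A := by
    intro N hN hsep
    have hdisj : Set.PairwiseDisjoint (↑N : Set V) (fun s => Metric.ball s (t / 2)) := by
      intro a ha b hb hab
      apply Metric.ball_disjoint_ball
      rw [dist_eq_norm]
      linarith [hsep a ha b hb hab]
    have h1 : μ (⋃ s ∈ N, Metric.ball s (t / 2)) = ∑ s ∈ N, μ (Metric.ball s (t / 2)) :=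
      measure_biUnion_finset hdisj (fun _ _ => measurableSet_ball)
    have h2 : (⋃ s ∈ N, Metric.ball s (t / 2)) ⊆ (3 / 2 : ℝ) • A := by
      intro y hy
      simp only [Set.mem_iUnion] at hy
      obtain ⟨s, hs, hy⟩ := hy
      rw [Metric.mem_ball, dist_eq_norm] at hy
      have hb : (2 : ℝ) • (y - s) ∈ A := by
        apply hball
        rw [mem_ball_zero_iff, norm_smul]
        norm_num
        linarith
      refine ⟨(2 / 3 : ℝ) • s + (1 / 3 : ℝ) • ((2 : ℝ) • (y - s)),
        hA (hA₀ (hN hs)) hb (by norm_num) (by norm_num) (by norm_num), ?_⟩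
      simp only
      module
    have h3 := measure_mono (μ := μ) h2
    have h4 : ∀ s ∈ N, μ (Metric.ball s (t / 2)) =
        ENNReal.ofReal ((t / 2) ^ d) * μ (Metric.ball 0 1) := by
      intro s _
      exact Measure.addHaar_ball_of_pos μ s (by positivity)
    rw [h1, Finset.sum_congr rfl h4, Finset.sum_const, nsmul_eq_mul, Measure.addHaar_smul,
      abs_of_nonneg (by positivity), ← hd, div_pow, div_pow,
      div_eq_mul_inv, div_eq_mul_inv, ENNReal.ofReal_mul (by positivity),
      ENNReal.ofReal_mul (by positivity)] at h3
    set c := ENNReal.ofReal ((2 ^ d)⁻¹) with hc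
    have hc0 : c ≠ 0 := by
      rw [hc]; simp
    have hct : c ≠ ⊤ := ENNReal.ofReal_ne_top
    refine (ENNReal.mul_le_mul_iff_right hc0 hct).1 ?_
    calc _ = _ := by ring
      _ ≤ _ := h3
      _ = _ := by ring
  have hpos : ENNReal.ofReal (t ^ d) * μ (Metric.ball (0:V) 1) ≠ 0 := by
    refine mul_ne_zero ?_ (Metric.measure_ball_pos μ 0 one_pos).ne'
    simp; positivity
  obtain ⟨M, hM⟩ : ∃ M : ℕ, ENNReal.ofReal (3 ^ d) * μ A /
      (ENNReal.ofReal (t ^ d) * μ (Metric.ball (0:V) 1)) < M :=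
    ENNReal.exists_nat_gt (ENNReal.div_lt_top (ENNReal.mul_ne_top ENNReal.ofReal_ne_top hAf) hpos).ne
  have hbd : ∀ N : Finset V, ↑N ⊆ A₀ → (∀ a ∈ N, ∀ b ∈ N, a ≠ b → t < ‖a - b‖) → N.card ≤ M := by
    intro N h1 h2
    have := ENNReal.le_div_iff_mul_le (Or.inl hpos)
      (Or.inl (ENNReal.mul_ne_top ENNReal.ofReal_ne_top measure_ball_lt_top.ne)) |>.2 (key N h1 h2)
    exact_mod_cast (this.trans_lt hM).le
  let P : ℕ → Prop := fun k => ∃ N : Finset V, ↑N ⊆ A₀ ∧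
    (∀ a ∈ N, ∀ b ∈ N, a ≠ b → t < ‖a - b‖) ∧ N.card = k
  classical
  have hP0 : P 0 := ⟨∅, by simp⟩
  obtain ⟨N, hN, hsep, hcard⟩ : P (Nat.findGreatest P M) := Nat.findGreatest_spec (Nat.zero_le M) hP0
  refine ⟨N, hN, ?_, key N hN hsep⟩
  intro a ha
  by_contra! hcon
  have haN : a ∉ N := fun h => by
    have := hcon a h
    simp at this; linarith
  have hins : P (N.card + 1) := by
    refine ⟨insert a N, ?_, ?_, Finset.card_insert_of_notMem haN⟩
    · rw [Finset.coe_insert]; exact Set.insert_subset ha hN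
    · intro p hp q hq hpq
      rw [Finset.mem_insert] at hp hq
      rcases hp with rfl | hp <;> rcases hq with rfl | hq
      · exact absurd rfl hpq
      · exact hcon q hq
      · rw [norm_sub_rev]; exact hcon p hp
      · exact hsep p hp q hq hpq
  obtain ⟨N', h1, h2, h3⟩ := hins
  have := Nat.le_findGreatest (P := P) (h3 ▸ hbd N' h1 h2) ⟨N', h1, h2, h3⟩
  omega

theorem aux_det (n : ℕ) (M : Matrix (Fin n) (Fin n) ℝ)
    (L : (Fin n → Euc n) →ₗ[ℝ] (Fin n → Euc n))
    (hL : ∀ y i, L y i = ∑ j, M i j • y j) : LinearMap.det L = M.det ^ n := by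
  let e : (Fin n → Euc n) ≃ₗ[ℝ] (Fin n → Euc n) :=
    { toFun := fun y k => WithLp.toLp 2 (fun i => y i k)
      invFun := fun y k => WithLp.toLp 2 (fun i => y i k)
      map_add' := fun y z => by ext; simp
      map_smul' := fun y z => by ext; simp
      left_inv := fun y => by ext; simp
      right_inv := fun y => by ext; simp }
  have h1 := LinearMap.det_conj L e
  have h2 : (e : (Fin n → Euc n) →ₗ[ℝ] (Fin n → Euc n)) ∘ₗ L ∘ₗ (e.symm : (Fin n → Euc n) →ₗ[ℝ] (Fin n → Euc n)) =
      LinearMap.pi (fun k => (Matrix.toEuclideanLin M) ∘ₗ LinearMap.proj k) := by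
    apply LinearMap.ext
    intro y
    ext k i
    simp [e, hL, Matrix.toLpLin_apply, Matrix.mulVec, dotProduct]
  rw [← h1, h2, LinearMap.det_pi]
  simp [Matrix.toEuclideanLin_eq_toLin, LinearMap.det_toLin]

theorem aux_absConv (n : ℕ) (x : Fin n → Euc n) :
    volume (absConv n (Set.range x)) =
      ENNReal.ofReal |(Matrix.of fun i j => x i j).det| * volume (absConv n (stdBasisSet n)) := by
  set M : Matrix (Fin n) (Fin n) ℝ := Matrix.of fun i j => x i j with hM
  have h : absConv n (Set.range x) = (Matrix.toEuclideanLin M.transpose) '' absConv n (stdBasisSet n) := by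
    unfold absConv stdBasisSet
    rw [LinearMap.image_convexHull, Set.image_union]
    have h1 : (Matrix.toEuclideanLin M.transpose) '' (Set.range fun i : Fin n => (EuclideanSpace.single i (1 : ℝ) : Euc n)) = Set.range x := by
      rw [← Set.range_comp]
      congr 1
      funext i
      ext j
      simp [Matrix.toLpLin_apply, hM]
    rw [Set.image_neg_of_apply_neg_eq_neg (f := Matrix.toEuclideanLin M.transpose) (g := Matrix.toEuclideanLin M.transpose) (fun y _ => by simp), h1]
  rw [h, Measure.addHaar_image_linearMap]
  simp [Matrix.toEuclideanLin_eq_toLin, LinearMap.det_toLin]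

theorem aux_net (n : ℕ) : ∃ N : Finset (Euc n), (∀ u ∈ N, ‖u‖ ≤ 1) ∧
    (∀ a : Euc n, ‖a‖ ≤ 1 → ∃ s ∈ N, ‖a - s‖ ≤ 1 / 4) ∧ (N.card : ℝ) ≤ 12 ^ n := by
  obtain ⟨N, h1, h2, h3⟩ := aux_pack (volume : Measure (Euc n)) (Metric.closedBall 0 1)
    (convex_closedBall _ _) measure_closedBall_lt_top.ne (1 / 4) (by norm_num)
    ((Metric.ball_subset_ball (by norm_num)).trans Metric.ball_subset_closedBall)
    (Metric.closedBall 0 1) le_rfl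
  refine ⟨N, fun u hu => by simpa using h1 hu, fun a ha => h2 a (by simpa using ha), ?_⟩
  rw [Measure.addHaar_unitClosedBall_eq_addHaar_unitBall, ← mul_assoc,
    ENNReal.mul_le_mul_iff_left (Metric.measure_ball_pos _ _ one_pos).ne' measure_ball_lt_top.ne,
    ← ENNReal.ofReal_natCast, ← ENNReal.ofReal_mul (by positivity),
    ENNReal.ofReal_le_ofReal_iff (by positivity), finrank_euclideanSpace_fin] at h3
  have h4 : (12 : ℝ) ^ n = 3 ^ n * 4 ^ n := by rw [← mul_pow]; norm_num
  have h5 : ((1 : ℝ) / 4) ^ n * 4 ^ n = 1 := by rw [← mul_pow]; norm_num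
  rw [h4]
  calc (N.card : ℝ) = N.card * (1 / 4) ^ n * 4 ^ n := by rw [mul_assoc, h5, mul_one]
    _ ≤ _ := by gcongr

theorem aux_opnorm (n : ℕ) (N : Finset (Euc n)) (h1 : ∀ u ∈ N, ‖u‖ ≤ 1)
    (h2 : ∀ a : Euc n, ‖a‖ ≤ 1 → ∃ s ∈ N, ‖a - s‖ ≤ 1 / 4) (T : Euc n →L[ℝ] Euc n) (s : ℝ)
    (hs : 0 ≤ s)
    (h : ∀ u ∈ N, ∀ v ∈ N, ⟪T u, v⟫ ≤ s) : ‖T‖ ≤ 2 * s := by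
  have key : ∀ x y : Euc n, ‖x‖ ≤ 1 → ‖y‖ ≤ 1 → ⟪T x, y⟫ ≤ s + ‖T‖ / 2 := by
    intro x y hx hy
    obtain ⟨u, hu, hxu⟩ := h2 x hx
    obtain ⟨v, hv, hyv⟩ := h2 y hy
    have e : ⟪T x, y⟫ = ⟪T u, v⟫ + ⟪T (x - u), v⟫ + ⟪T x, y - v⟫ := by
      simp only [map_sub, inner_sub_left, inner_sub_right]; ring
    have e1 : ⟪T (x - u), v⟫ ≤ ‖T‖ / 4 := by
      calc _ ≤ ‖T (x - u)‖ * ‖v‖ := real_inner_le_norm _ _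
        _ ≤ (‖T‖ * (1 / 4)) * 1 := by
          gcongr
          · exact (T.le_opNorm _).trans (by gcongr)
          · exact h1 v hv
        _ = _ := by ring
    have e2 : ⟪T x, y - v⟫ ≤ ‖T‖ / 4 := by
      calc _ ≤ ‖T x‖ * ‖y - v‖ := real_inner_le_norm _ _
        _ ≤ (‖T‖ * 1) * (1 / 4) := by
          gcongr
          exact (T.le_opNorm _).trans (by gcongr)
        _ = _ := by ring
    have := h u hu v hv
    linarith
  have hb : ‖T‖ ≤ s + ‖T‖ / 2 := by
    refine ContinuousLinearMap.opNorm_le_of_unit_norm (by positivity) ?_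
    intro x hx
    by_cases h0 : T x = 0
    · rw [h0, norm_zero]; positivity
    have := key x (‖T x‖⁻¹ • T x) hx.le (by rw [norm_smul, norm_inv, norm_norm, inv_mul_cancel₀ (norm_ne_zero_iff.2 h0)])
    rw [inner_smul_right, real_inner_self_eq_norm_sq] at this
    have hne : ‖T x‖ ≠ 0 := norm_ne_zero_iff.2 h0
    have e : ‖T x‖⁻¹ * ‖T x‖ ^ 2 = ‖T x‖ := by field_simp
    linarith
  linarith

theorem aux_gauss (n : ℕ) (hn : 0 < n) (Φ : (Fin n → Euc n) → Euc n →L[ℝ] Euc n)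
    (hΦ : ∀ y u, Φ y u = ∑ i, u i • y i) :
    volume (Metric.closedBall (0 : Euc n) 1) ^ n ≤
      ENNReal.ofReal (2 * 3 ^ (n ^ 2)) * volume {y | ‖Φ y‖ ≤ 8} := by
  obtain ⟨N, h1, h2, h3⟩ := aux_net n
  let F : (Fin n → Euc n) → ℝ := fun y => Real.exp (-(n * ∑ i, ‖y i‖ ^ 2))
  have hFc : Continuous F := by fun_prop
  have hFm : Measurable fun y => ENNReal.ofReal (F y) := by fun_prop
  have hnR : (0 : ℝ) < n := by exact_mod_cast hn
  set I := ∫⁻ y, ENNReal.ofReal (F y) with hI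
  have hIfin : I ≠ ⊤ := by
    have hg : Integrable (fun y : Euc n => Real.exp (-((n : ℝ)) * ‖y‖ ^ 2)) := by
      have := GaussianFourier.integrable_cexp_neg_mul_sq_norm_add (V := Euc n) (b := n)
        (by simpa using hn) 0 0
      refine (this.norm).congr (Filter.Eventually.of_forall fun y => ?_)
      simp only [Complex.norm_exp]
      congr 1
      simp [← Complex.ofReal_pow]
    have hp := Integrable.fintype_prod (ι := Fin n) (μ := fun _ => (volume : Measure (Euc n)))
      (f := fun _ (y : Euc n) => Real.exp (-((n : ℝ)) * ‖y‖ ^ 2)) (fun _ => hg)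
    have hF : Integrable F := by
      refine hp.congr (Filter.Eventually.of_forall fun y => ?_)
      simp only [F]
      rw [← Real.exp_sum, ← Finset.mul_sum, neg_mul]
    exact hF.lintegral_lt_top.ne
  set K := {y | ‖Φ y‖ ≤ 8} with hK
  have hball : volume (Metric.closedBall (0 : Euc n) 1) ^ n ≤ ENNReal.ofReal (3 ^ (n ^ 2)) * I := by
    let Q : Set (Fin n → Euc n) := Set.pi Set.univ fun _ => Metric.closedBall (0 : Euc n) 1
    have hQ : volume Q = volume (Metric.closedBall (0 : Euc n) 1) ^ n := by
      rw [volume_pi_pi]; simp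
    rw [← hQ, hI, ← lintegral_const_mul _ hFm, ← setLIntegral_one]
    refine le_trans (setLIntegral_mono (hFm.const_mul _) ?_) (setLIntegral_le_lintegral Q _)
    intro y hy
    rw [← ENNReal.ofReal_mul (by positivity), ENNReal.one_le_ofReal]
    have hs : ∑ i, ‖y i‖ ^ 2 ≤ n := by
      calc ∑ i, ‖y i‖ ^ 2 ≤ ∑ i : Fin n, (1 : ℝ) := by
            refine Finset.sum_le_sum fun i _ => ?_
            have : ‖y i‖ ≤ 1 := by simpa using hy i (Set.mem_univ _)
            nlinarith [norm_nonneg (y i)]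
        _ = n := by simp
    have h3e : Real.exp ((n : ℝ) ^ 2) ≤ 3 ^ (n ^ 2) := by
      have : Real.exp ((n : ℝ) ^ 2) = Real.exp 1 ^ (n ^ 2) := by
        rw [← Real.exp_nat_mul]; simp
      rw [this]
      gcongr
      linarith [Real.exp_one_lt_d9]
    calc (1 : ℝ) = Real.exp ((n : ℝ) ^ 2) * Real.exp (-(n : ℝ) ^ 2) := by
          rw [← Real.exp_add]; simp
      _ ≤ _ := by
        gcongr
        simp only [F]
        rw [Real.exp_le_exp]
        nlinarith
  have hhalf : I ≤ 2 * volume K := by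
    have hK1 : ∫⁻ y in K, ENNReal.ofReal (F y) ≤ volume K := by
      rw [← setLIntegral_one]
      refine lintegral_mono fun y => ?_
      rw [ENNReal.ofReal_le_one]
      simp only [F]
      rw [Real.exp_le_one_iff]
      have : 0 ≤ (n : ℝ) * ∑ i, ‖y i‖ ^ 2 := by positivity
      linarith
    let w : Euc n × Euc n → (Fin n → Euc n) := fun p i => p.1 i • p.2
    have hK2 : ∫⁻ y in Kᶜ, ENNReal.ofReal (F y) ≤ ENNReal.ofReal (1 / 2) * I := by
      have hpt : ∀ y ∈ Kᶜ, ENNReal.ofReal (F y) ≤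
          ∑ p ∈ N ×ˢ N, ENNReal.ofReal (Real.exp (-(7 * n))) * ENNReal.ofReal (F (y - w p)) := by
        intro y hy
        have hex : ∃ u ∈ N, ∃ v ∈ N, 4 < ⟪Φ y u, v⟫ := by
          by_contra! hc
          have := aux_opnorm n N h1 h2 (Φ y) 4 (by norm_num) hc
          apply hy
          simp only [hK, Set.mem_setOf_eq]
          linarith
        obtain ⟨u, hu, v, hv, huv⟩ := hex
        refine le_trans ?_ (Finset.single_le_sum (f := fun p => ENNReal.ofReal (Real.exp (-(7 * n))) * ENNReal.ofReal (F (y - w p)))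
          (fun _ _ => zero_le) (Finset.mk_mem_product hu hv))
        rw [← ENNReal.ofReal_mul (by positivity)]
        apply ENNReal.ofReal_le_ofReal
        simp only [F]
        rw [← Real.exp_add, Real.exp_le_exp]
        have e1 : ∑ i, ‖(y - w (u, v)) i‖ ^ 2 =
            ∑ i, ‖y i‖ ^ 2 - 2 * ⟪Φ y u, v⟫ + (∑ i, u i ^ 2) * ‖v‖ ^ 2 := by
          rw [hΦ, sum_inner, Finset.mul_sum, Finset.sum_mul, ← Finset.sum_sub_distrib,
            ← Finset.sum_add_distrib]
          refine Finset.sum_congr rfl fun i _ => ?_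
          simp only [w, Pi.sub_apply]
          rw [norm_sub_sq_real, inner_smul_left, inner_smul_right, norm_smul, mul_pow]
          simp
        have e2 : (∑ i, u i ^ 2) * ‖v‖ ^ 2 ≤ 1 := by
          have : ∑ i, u i ^ 2 = ‖u‖ ^ 2 := by
            rw [EuclideanSpace.norm_sq_eq]; simp
          rw [this, ← mul_pow]
          have := h1 u hu
          have := h1 v hv
          have : ‖u‖ * ‖v‖ ≤ 1 := mul_le_one₀ (h1 u hu) (norm_nonneg _) (h1 v hv)
          exact pow_le_one₀ (by positivity) this
        rw [e1]
        nlinarith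
      have hm : Measurable fun y => ∑ p ∈ N ×ˢ N, ENNReal.ofReal (Real.exp (-(7 * n))) * ENNReal.ofReal (F (y - w p)) := by
        fun_prop
      refine ((setLIntegral_mono hm hpt).trans (setLIntegral_le_lintegral _ _)).trans ?_
      rw [lintegral_finsetSum _ (fun p _ => by fun_prop)]
      have : ∀ p ∈ N ×ˢ N, ∫⁻ y, ENNReal.ofReal (Real.exp (-(7 * n))) * ENNReal.ofReal (F (y - w p)) =
          ENNReal.ofReal (Real.exp (-(7 * n))) * I := by
        intro p _
        rw [lintegral_const_mul _ (by fun_prop), hI,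
          lintegral_sub_right_eq_self (fun y => ENNReal.ofReal (F y)) (w p)]
      rw [Finset.sum_congr rfl this, Finset.sum_const, nsmul_eq_mul, ← mul_assoc,
        ← ENNReal.ofReal_natCast, ← ENNReal.ofReal_mul (by positivity)]
      gcongr
      rw [Finset.card_product]
      push_cast
      have e7 : Real.exp (-(7 * n)) = (Real.exp (-7)) ^ n := by
        rw [← Real.exp_nat_mul]; ring_nf
      have e8 : 144 * Real.exp (-7) ≤ 1 / 2 := by
        have : (288 : ℝ) ≤ Real.exp 7 := by
          have : Real.exp 7 = Real.exp 1 ^ 7 := by rw [← Real.exp_nat_mul]; norm_num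
          rw [this]
          calc (288 : ℝ) ≤ 2.7 ^ 7 := by norm_num
            _ ≤ _ := by gcongr; linarith [Real.exp_one_gt_d9]
        rw [Real.exp_neg]
        have h0 := Real.exp_pos 7
        rw [← div_eq_mul_inv, div_le_iff₀ h0]
        linarith
      calc (N.card : ℝ) * N.card * Real.exp (-(7 * n)) ≤ 12 ^ n * 12 ^ n * Real.exp (-7) ^ n := by
            rw [e7]; gcongr
        _ = (144 * Real.exp (-7)) ^ n := by rw [← mul_pow, ← mul_pow]; norm_num
        _ ≤ (1 / 2) ^ n := by gcongr
        _ ≤ (1 / 2) ^ 1 := pow_le_pow_of_le_one (by norm_num) (by norm_num) hn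
        _ = 1 / 2 := by norm_num
    have hsum : I ≤ volume K + ENNReal.ofReal (1 / 2) * I := by
      calc I = ∫⁻ y in K ∪ Kᶜ, ENNReal.ofReal (F y) := by simp [hI]
        _ ≤ _ := lintegral_union_le _ _ _
        _ ≤ _ := add_le_add hK1 hK2
    have h2I : I + I ≤ 2 * volume K + I := by
      calc I + I = 2 * I := by ring
        _ ≤ 2 * (volume K + ENNReal.ofReal (1 / 2) * I) := by gcongr
        _ = 2 * volume K + (2 * ENNReal.ofReal (1 / 2)) * I := by ring
        _ = 2 * volume K + I := by
          have : (2 : ℝ≥0∞) * ENNReal.ofReal (1 / 2) = 1 := by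
            rw [← ENNReal.ofReal_ofNat, ← ENNReal.ofReal_mul (by norm_num)]; norm_num
          rw [this, one_mul]
    exact (ENNReal.add_le_add_iff_right hIfin).1 h2I
  calc _ ≤ _ := hball
    _ ≤ ENNReal.ofReal (3 ^ (n ^ 2)) * (2 * volume K) := by gcongr
    _ = _ := by rw [ENNReal.ofReal_mul (by norm_num), ENNReal.ofReal_ofNat]; ring

theorem statement_5 :
    ∃ C₀ : ℝ, 0 < C₀ ∧
      ∀ (n : ℕ), 0 < n → ∀ (x : Fin n → Euc n), LinearIndependent ℝ x →
      ∀ (B : Set (Euc n)), IsSymmConvexBody n B →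
      ∀ r : ℝ, 0 < r → Metric.closedBall (0 : Euc n) r ⊆ B →
      ∀ t : ℝ, 0 < t → t ≤ r * (⨆ j, ‖x j‖)⁻¹ →
      ∀ A₀ : Set (Euc n →ₗ[ℝ] Euc n), A₀ ⊆ {R | ∀ i, R (x i) ∈ B} →
      ∃ N : Finset (Euc n →ₗ[ℝ] Euc n), ↑N ⊆ A₀ ∧
        (∀ R ∈ A₀, ∃ S ∈ N, eucOpNorm n (R - S) ≤ t) ∧
        (N.card : ℝ≥0∞) * volume (Metric.closedBall (0 : Euc n) 1) ^ n *
            volume (absConv n (Set.range x)) ^ n ≤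
          ENNReal.ofReal ((C₀ / t) ^ (n ^ 2)) * volume B ^ n *
            volume (absConv n (stdBasisSet n)) ^ n := by
  refine ⟨144, by norm_num, ?_⟩
  intro n hn x hx B hB r hr hrB t ht htr A₀ hA₀
  obtain ⟨hBc, hBs, hBk, hB0⟩ := hB
  let b := (EuclideanSpace.basisFun (Fin n) ℝ).toBasis
  let Φl : (Fin n → Euc n) ≃ₗ[ℝ] (Euc n →L[ℝ] Euc n) :=
    (b.constr ℝ).trans LinearMap.toContinuousLinearMap
  let Φ : (Fin n → Euc n) ≃L[ℝ] (Euc n →L[ℝ] Euc n) := Φl.toContinuousLinearEquiv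
  have hΦ : ∀ y u, Φ y u = ∑ i, u i • y i := by
    intro y u
    change (b.constr ℝ y) u = _
    rw [Module.Basis.constr_apply_fintype]
    simp [b]
  let μ : Measure (Euc n →L[ℝ] Euc n) := Measure.map Φ volume
  have : μ.IsAddHaarMeasure := Φ.isAddHaarMeasure_map volume
  have hμ : ∀ S, μ S = volume (Φ ⁻¹' S) := fun S =>
    Φ.toHomeomorph.toMeasurableEquiv.map_apply S
  have hfr : Module.finrank ℝ (Euc n →L[ℝ] Euc n) = n ^ 2 := by
    rw [← Φl.finrank_eq, Module.finrank_pi_fintype]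
    simp [sq]
  set M : Matrix (Fin n) (Fin n) ℝ := Matrix.of fun i j => x i j with hM
  let L : (Fin n → Euc n) →ₗ[ℝ] (Fin n → Euc n) :=
    LinearMap.pi fun i => ∑ j, M i j • LinearMap.proj j
  have hL : ∀ y i, L y i = ∑ j, M i j • y j := by
    intro y i
    simp [L]
  have hdet := aux_det n M L hL
  have hMdet : M.det ≠ 0 := by
    have hli : LinearIndependent ℝ M.row := by
      have := hx.map' (WithLp.linearEquiv 2 ℝ (Fin n → ℝ)).toLinearMap (LinearEquiv.ker _)
      exact this
    have := Matrix.linearIndependent_rows_iff_isUnit.1 hli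
    exact ((Matrix.isUnit_iff_isUnit_det _).1 this).ne_zero
  let A : Set (Euc n →L[ℝ] Euc n) := {R | ∀ i, R (x i) ∈ B}
  have hAconv : Convex ℝ A := by
    intro R hR S hS p q hp hq hpq i
    exact hBc (hR i) (hS i) hp hq hpq
  have hAvol : μ A * ENNReal.ofReal |M.det| ^ n = volume B ^ n := by
    have hpre : Φ ⁻¹' A = L ⁻¹' (Set.pi Set.univ fun _ => B) := by
      ext y
      simp only [A, Set.mem_preimage, Set.mem_setOf_eq, Set.mem_pi, Set.mem_univ, true_imp_iff,
        hL, hΦ, hM, Matrix.of_apply]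
    rw [hμ, hpre, Measure.addHaar_preimage_linearMap _ (by rw [hdet]; exact pow_ne_zero _ hMdet),
      volume_pi_pi, hdet, ← ENNReal.ofReal_pow (abs_nonneg _), ← abs_pow]
    rw [mul_comm, ← mul_assoc, ← ENNReal.ofReal_mul (abs_nonneg _), ← abs_mul,
      mul_inv_cancel₀ (pow_ne_zero _ hMdet)]
    simp
  have hd0 : ENNReal.ofReal |M.det| ≠ 0 := by simpa using hMdet
  have hAfin : μ A ≠ ⊤ := by
    intro h
    rw [h, ENNReal.top_mul (pow_ne_zero _ hd0)] at hAvol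
    exact ENNReal.pow_ne_top hBk.measure_lt_top.ne hAvol.symm
  have hball : Metric.ball (0 : Euc n →L[ℝ] Euc n) t ⊆ A := by
    intro R hR i
    apply hrB
    rw [mem_ball_zero_iff] at hR
    rw [mem_closedBall_zero_iff]
    have hle : ‖x i‖ ≤ ⨆ j, ‖x j‖ := le_ciSup (f := fun j => ‖x j‖) (Set.finite_range _).bddAbove i
    have hxi : 0 < ‖x i‖ := norm_pos_iff.2 (hx.ne_zero i)
    have hs : 0 < ⨆ j, ‖x j‖ := hxi.trans_le hle
    rw [← div_eq_mul_inv, le_div_iff₀ hs] at htr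
    calc ‖R (x i)‖ ≤ ‖R‖ * ‖x i‖ := R.le_opNorm _
      _ ≤ t * ⨆ j, ‖x j‖ := by gcongr
      _ ≤ r := htr
  let e : (Euc n →ₗ[ℝ] Euc n) ≃ₗ[ℝ] (Euc n →L[ℝ] Euc n) := LinearMap.toContinuousLinearMap
  obtain ⟨N, hN1, hN2, hN3⟩ := aux_pack μ A hAconv hAfin t ht hball (e '' A₀) (by
    rintro _ ⟨R, hR, rfl⟩ i
    exact hA₀ hR i)
  refine ⟨N.map e.symm.toEquiv.toEmbedding, ?_, ?_, ?_⟩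
  · intro R hR
    simp only [Finset.coe_map, Set.mem_image] at hR
    obtain ⟨S, hS, rfl⟩ := hR
    obtain ⟨T, hT, rfl⟩ := hN1 hS
    simpa using hT
  · intro R hR
    obtain ⟨S, hS, hRS⟩ := hN2 (e R) ⟨R, hR, rfl⟩
    refine ⟨e.symm S, Finset.mem_map_of_mem _ hS, ?_⟩
    have : LinearMap.toContinuousLinearMap (R - e.symm S) = e R - S := by
      change e (R - e.symm S) = _
      rw [map_sub, e.apply_symm_apply]
    rw [eucOpNorm, this]
    exact hRS
  · rw [Finset.card_map, aux_absConv n x, mul_pow, ← mul_assoc, ← hM]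
    refine mul_le_mul_left ?_ _
    have hg := aux_gauss n hn (fun y => Φ y) hΦ
    have hK : volume {y | ‖Φ y‖ ≤ 8} = ENNReal.ofReal (8 ^ n ^ 2) * μ (Metric.ball 0 1) := by
      rw [← hfr, ← Measure.addHaar_closedBall μ 0 (by norm_num), hμ]
      congr 1
      ext y
      simp
    rw [hK] at hg
    rw [hfr] at hN3
    set m := μ (Metric.ball 0 1) with hm
    set d := ENNReal.ofReal |M.det| ^ n with hd
    have hreal : ENNReal.ofReal (2 * 3 ^ n ^ 2) * ENNReal.ofReal (8 ^ n ^ 2) ≤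
        ENNReal.ofReal ((48 / t) ^ n ^ 2) * ENNReal.ofReal (t ^ n ^ 2) := by
      rw [← ENNReal.ofReal_mul (by positivity), ← ENNReal.ofReal_mul (by positivity)]
      apply ENNReal.ofReal_le_ofReal
      rw [← mul_pow, div_mul_cancel₀ _ ht.ne']
      have h2 : (2 : ℝ) ≤ 2 ^ n ^ 2 := le_self_pow₀ (by norm_num) (by positivity)
      calc (2 : ℝ) * 3 ^ n ^ 2 * 8 ^ n ^ 2 ≤ 2 ^ n ^ 2 * 3 ^ n ^ 2 * 8 ^ n ^ 2 := by gcongr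
        _ = 48 ^ n ^ 2 := by rw [← mul_pow, ← mul_pow]; norm_num
    calc (N.card : ℝ≥0∞) * volume (Metric.closedBall (0 : Euc n) 1) ^ n * d
        ≤ N.card * (ENNReal.ofReal (2 * 3 ^ n ^ 2) * (ENNReal.ofReal (8 ^ n ^ 2) * m)) * d := by
          gcongr
      _ = N.card * m * d * (ENNReal.ofReal (2 * 3 ^ n ^ 2) * ENNReal.ofReal (8 ^ n ^ 2)) := by ring
      _ ≤ N.card * m * d * (ENNReal.ofReal ((48 / t) ^ n ^ 2) * ENNReal.ofReal (t ^ n ^ 2)) := by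
          gcongr
      _ = ENNReal.ofReal ((48 / t) ^ n ^ 2) * d * (N.card * (ENNReal.ofReal (t ^ n ^ 2) * m)) := by
          ring
      _ ≤ ENNReal.ofReal ((48 / t) ^ n ^ 2) * d * (ENNReal.ofReal (3 ^ n ^ 2) * μ A) := by
          gcongr
      _ = ENNReal.ofReal ((48 / t) ^ n ^ 2) * ENNReal.ofReal (3 ^ n ^ 2) * (μ A * d) := by ring
      _ = ENNReal.ofReal ((144 / t) ^ n ^ 2) * volume B ^ n := by
          rw [hAvol, ← ENNReal.ofReal_mul (by positivity), ← mul_pow]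
          congr 3
          ring

end
end

section
/- Let B be a centrally symmetric convex body in ℝⁿ and let Q be a parallelepiped (the image of the cube [−1,1]ⁿ under an invertible linear map) contained in the polar body B°. Then vol_n(Q)^{1/n} ≤ (2/n)·π₁(I_n : X_B* → ℓ₂ⁿ). -/
open MeasureTheory Set
open scoped ENNReal RealInnerProductSpace Pointwise BigOperators

noncomputable section

lemma aux_vol (n : ℕ) (S : Euc n ≃ₗ[ℝ] Euc n) :
    (volume ((S : Euc n →ₗ[ℝ] Euc n) '' {x : Euc n | ∀ i, |x i| ≤ 1})).toReal =
      |LinearMap.det (S : Euc n →ₗ[ℝ] Euc n)| * 2 ^ n := by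
  have h0 : (volume {x : Euc n | ∀ i, |x i| ≤ 1}) = ENNReal.ofReal (2 ^ n) := by
    have h1 : {x : Euc n | ∀ i, |x i| ≤ 1} =
        (@WithLp.ofLp 2 (Fin n → ℝ)) ⁻¹' (Set.Icc (fun _ => -1) (fun _ => 1)) := by
      ext x
      simp only [Set.mem_setOf_eq, Set.mem_preimage, Set.mem_Icc, Pi.le_def, abs_le]
      exact forall_and
    rw [h1, (PiLp.volume_preserving_ofLp (Fin n)).measure_preimage
      measurableSet_Icc.nullMeasurableSet, Real.volume_Icc_pi]
    rw [Finset.prod_const, ← ENNReal.ofReal_pow (by norm_num)]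
    norm_num
  rw [Measure.addHaar_image_linearMap, h0, ENNReal.toReal_mul,
    ENNReal.toReal_ofReal (abs_nonneg _), ENNReal.toReal_ofReal (by positivity)]

lemma aux_had (n : ℕ) (S : Euc n →ₗ[ℝ] Euc n) :
    |LinearMap.det S| ≤ ∏ i, ‖S (EuclideanSpace.single i 1)‖ := by
  haveI : Fact (Module.finrank ℝ (Euc n) = n) := ⟨by simp⟩
  let b := EuclideanSpace.basisFun (Fin n) ℝ
  have h := b.toBasis.orientation.abs_volumeForm_apply_le
    (fun i => S (EuclideanSpace.single i 1))
  rw [b.toBasis.orientation.volumeForm_robust' b] at h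
  have h2 := b.toBasis.det_comp S b.toBasis
  rw [Module.Basis.det_self, mul_one] at h2
  rw [← h2]
  convert h using 4
  ext i : 1
  simp [b]

lemma aux_bdd (n : ℕ) (B : Set (Euc n)) (hB : IsCompact B) (N : ℕ) (z : Fin N → Euc n) :
    BddAbove ((fun y => ∑ j, |⟪y, z j⟫|) '' B) := by
  apply hB.bddAbove_image
  fun_prop

lemma aux_l1 (n : ℕ) (x : Euc n) : ‖x‖ ≤ ∑ i, |x i| := by
  have h := (EuclideanSpace.basisFun (Fin n) ℝ).sum_repr x
  conv_lhs => rw [← h]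
  refine (norm_sum_le _ _).trans (Finset.sum_le_sum fun i _ => ?_)
  simp [norm_smul]

lemma aux_nonempty (n : ℕ) (hn : 0 < n) (B : Set (Euc n)) (hB : IsSymmConvexBody n B) :
    {α : ℝ | 0 < α ∧ ∀ N : ℕ, ∀ z : Fin N → Euc n,
      ∑ j, ‖z j‖ ≤ α * sSup ((fun y => ∑ j, |⟪y, z j⟫|) '' B)}.Nonempty := by
  obtain ⟨-, -, hc, h0⟩ := hB
  rw [mem_interior_iff_mem_nhds, Metric.nhds_basis_closedBall.mem_iff] at h0
  obtain ⟨r, hr, hrB⟩ := h0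
  have hn' : (0 : ℝ) < n := by exact_mod_cast hn
  refine ⟨n / r, by positivity, fun N z => ?_⟩
  set M := sSup ((fun y => ∑ j, |⟪y, z j⟫|) '' B)
  have h1 : ∀ i : Fin n, r * ∑ j, |z j i| ≤ M := by
    intro i
    have hy : (EuclideanSpace.single i r : Euc n) ∈ B := hrB (by simp [abs_of_pos hr])
    have := le_csSup (aux_bdd n B hc N z) (Set.mem_image_of_mem _ hy)
    refine le_trans (le_of_eq ?_) this
    simp [EuclideanSpace.inner_single_left, abs_mul, abs_of_pos hr, Finset.mul_sum]
  have h2 : r * ∑ j, ‖z j‖ ≤ n * M := by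
    calc r * ∑ j, ‖z j‖ ≤ r * ∑ j, ∑ i, |z j i| := by
          gcongr with j; exact aux_l1 n _
      _ = ∑ i, r * ∑ j, |z j i| := by rw [Finset.sum_comm, Finset.mul_sum]
      _ ≤ ∑ _i : Fin n, M := Finset.sum_le_sum fun i _ => h1 i
      _ = n * M := by simp
  rw [div_mul_eq_mul_div, le_div_iff₀ hr]
  linarith

lemma aux_pi (n : ℕ) (hn : 0 < n) (B : Set (Euc n)) (hB : IsSymmConvexBody n B)
    (S : Euc n ≃ₗ[ℝ] Euc n)
    (hQ : (S : Euc n →ₗ[ℝ] Euc n) '' {x : Euc n | ∀ i, |x i| ≤ 1} ⊆ polarBody n B) :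
    ∑ i, ‖S (EuclideanSpace.single i 1)‖ ≤ piOneId n B := by
  apply le_csInf (aux_nonempty n hn B hB)
  rintro α ⟨hα, h⟩
  refine (h n (fun i => S (EuclideanSpace.single i 1))).trans ?_
  have hs : sSup ((fun y => ∑ j, |⟪y, S (EuclideanSpace.single j 1)⟫|) '' B) ≤ 1 := by
    apply csSup_le (Set.Nonempty.image _ ⟨0, interior_subset hB.2.2.2⟩)
    rintro _ ⟨y, hy, rfl⟩
    let ε : Euc n := WithLp.toLp 2 fun j =>
      ((SignType.sign ⟪y, S (EuclideanSpace.single j 1)⟫ : SignType) : ℝ)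
    have hε : ∀ i, |ε i| ≤ 1 := by
      intro i
      simp only [ε]
      cases SignType.sign ⟪y, S (EuclideanSpace.single i 1)⟫ <;> simp
    have h1 := hQ ⟨ε, hε, rfl⟩ y hy
    have h2 : ε = ∑ j, ε j • (EuclideanSpace.single j 1 : Euc n) := by
      simpa using ((EuclideanSpace.basisFun (Fin n) ℝ).sum_repr ε).symm
    refine le_trans (le_of_eq ?_) h1
    rw [h2]
    simp only [map_sum, map_smul, inner_sum, inner_smul_right, LinearEquiv.coe_coe]
    refine Finset.sum_congr rfl fun j _ => ?_
    simp only [ε]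
    exact (sign_mul_self _).symm
  nlinarith

theorem statement_13 (n : ℕ) (hn : 0 < n) (B : Set (Euc n)) (hB : IsSymmConvexBody n B)
    (S : Euc n ≃ₗ[ℝ] Euc n)
    (hQ : (S : Euc n →ₗ[ℝ] Euc n) '' {x : Euc n | ∀ i, |x i| ≤ 1} ⊆ polarBody n B) :
    (volume ((S : Euc n →ₗ[ℝ] Euc n) '' {x : Euc n | ∀ i, |x i| ≤ 1})).toReal ^ ((1 : ℝ) / n) ≤
      (2 / n) * piOneId n B := by
  have hn' : (0 : ℝ) < n := by exact_mod_cast hn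
  rw [aux_vol]
  have h1 := aux_had n (S : Euc n →ₗ[ℝ] Euc n)
  have h2 := aux_pi n hn B hB S hQ
  have h3 := Real.geom_mean_le_arith_mean Finset.univ (fun _ : Fin n => (1 : ℝ))
    (fun i => ‖S (EuclideanSpace.single i 1)‖) (by simp) (by simpa using hn) (by simp)
  simp only [Real.rpow_one, Finset.sum_const, Finset.card_univ, Fintype.card_fin, nsmul_eq_mul,
    mul_one, one_mul] at h3
  rw [Real.mul_rpow (abs_nonneg _) (by positivity), ← Real.rpow_natCast, ← Real.rpow_mul (by norm_num),
    mul_one_div_cancel hn'.ne', Real.rpow_one, one_div]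
  calc |LinearMap.det (S : Euc n →ₗ[ℝ] Euc n)| ^ ((n : ℝ)⁻¹) * 2
      ≤ (∏ i, ‖S (EuclideanSpace.single i 1)‖) ^ ((n : ℝ)⁻¹) * 2 := by
        gcongr
        exact h1
    _ ≤ ((∑ i, ‖S (EuclideanSpace.single i 1)‖) / n) * 2 := by gcongr
    _ ≤ (piOneId n B / n) * 2 := by gcongr
    _ = 2 / n * piOneId n B := by ring


end
end

section
/- Let n ≥ 2 and let P ∈ M_n(ℝ) be a linear projection (P² = P, not necessarily orthogonal) of rank s with 1 ≤ s ≤ n−1. Then the operator 2P is (min{s, n−s}, 1)-mixing, i.e. 2P ∈ Mix_n(min{s, n−s}, 1). -/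
open MeasureTheory Set
open scoped ENNReal RealInnerProductSpace Pointwise BigOperators

noncomputable section

theorem exists_isom_aux {M K : Type*} [NormedAddCommGroup M] [InnerProductSpace ℝ M]
    [FiniteDimensional ℝ M] [NormedAddCommGroup K] [InnerProductSpace ℝ K]
    [FiniteDimensional ℝ K] (B : M →ₗ[ℝ] K)
    (h : Module.finrank ℝ M ≤ Module.finrank ℝ K) :
    ∃ V : M →ₗᵢ[ℝ] K, ∀ m, 0 ≤ inner ℝ (B m) (V m) := by
  have hT : (B.adjoint ∘ₗ B).IsSymmetric := by
    intro x y
    simp [LinearMap.adjoint_inner_left, LinearMap.adjoint_inner_right]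
  let u := hT.eigenvectorBasis rfl
  have hu : ∀ i j, i ≠ j → inner ℝ (B (u i)) (B (u j)) = 0 := by
    intro i j hij
    have h1 : (B.adjoint ∘ₗ B) (u j) = (hT.eigenvalues rfl j : ℝ) • u j :=
      hT.apply_eigenvectorBasis rfl j
    rw [← LinearMap.adjoint_inner_right, ← LinearMap.comp_apply, h1, inner_smul_right,
      u.orthonormal.2 hij, mul_zero]
  let f : Fin (Module.finrank ℝ K) → K := fun i =>
    if hi : (i : ℕ) < Module.finrank ℝ M then B (u ⟨i, hi⟩) else 0
  have hf : Pairwise fun i j => inner ℝ (f i) (f j) = 0 := by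
    intro i j hij
    simp only [f]
    split_ifs with h1 h2
    · apply hu
      intro h
      apply hij
      ext
      simpa using h
    all_goals simp
  let κ := InnerProductSpace.gramSchmidtOrthonormalBasis (𝕜 := ℝ)
    (Fintype.card_fin (Module.finrank ℝ K)).symm f
  let g := fun i => κ (Fin.castLE h i)
  have hg : Orthonormal ℝ g := κ.orthonormal.comp _ (Fin.castLE_injective h)
  have hB : ∀ i, B (u i) = ‖B (u i)‖ • g i := by
    intro i
    have hfi : f (Fin.castLE h i) = B (u i) := by simp [f]
    by_cases h0 : B (u i) = 0
    · simp [h0]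
    · have := InnerProductSpace.gramSchmidtOrthonormalBasis_apply_of_orthogonal (𝕜 := ℝ)
        (Fintype.card_fin (Module.finrank ℝ K)).symm hf (i := Fin.castLE h i) (by rwa [hfi])
      simp only [g, κ]
      rw [this, hfi, smul_smul]
      have : ‖B (u i)‖ ≠ 0 := by simpa using h0
      simp [this]
  let V0 : M →ₗ[ℝ] K := u.toBasis.constr ℝ g
  have hV0 : ∀ i, V0 (u i) = g i := by
    intro i
    have := u.toBasis.constr_basis ℝ g i
    rwa [u.coe_toBasis] at this
  have hu' : Orthonormal ℝ u.toBasis := by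
    rw [u.coe_toBasis]
    exact u.orthonormal
  have hc : Orthonormal ℝ (V0 ∘ u.toBasis) := by
    have : V0 ∘ u.toBasis = g := by
      rw [u.coe_toBasis]
      exact funext hV0
    rw [this]
    exact hg
  refine ⟨V0.isometryOfOrthonormal hu' hc, ?_⟩
  · intro m
    rw [LinearMap.coe_isometryOfOrthonormal]
    have e1 : B m = ∑ i, (u.repr m i * ‖B (u i)‖) • g i := by
      conv_lhs => rw [← u.sum_repr m]
      rw [map_sum]
      refine Finset.sum_congr rfl fun i _ => ?_
      rw [map_smul, mul_smul, ← hB]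
    have e2 : V0 m = ∑ i, (u.repr m i) • g i := by
      conv_lhs => rw [← u.sum_repr m]
      rw [map_sum]
      refine Finset.sum_congr rfl fun i _ => ?_
      rw [map_smul, hV0]
    rw [e1, e2, hg.inner_sum]
    refine Finset.sum_nonneg fun i _ => ?_
    have := mul_nonneg (norm_nonneg (B (u i))) (mul_self_nonneg (u.repr m i))
    simp only [conj_trivial]
    linarith

theorem mixing_aux (n : ℕ) (P : Euc n →ₗ[ℝ] Euc n) (hP : P ∘ₗ P = P)
    (h : Module.finrank ℝ (LinearMap.range P) ≤ Module.finrank ℝ (LinearMap.ker P)) :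
    IsMixing n ((2 : ℝ) • P) (Module.finrank ℝ (LinearMap.range P)) 1 := by
  have hPP : ∀ x, P (P x) = P x := fun x => LinearMap.congr_fun hP x
  have hd : Module.finrank ℝ ((LinearMap.ker P)ᗮ : Submodule ℝ (Euc n))
      = Module.finrank ℝ (LinearMap.range P) := by
    have h1 := (LinearMap.ker P).finrank_add_finrank_orthogonal
    have h2 := P.finrank_range_add_finrank_ker
    omega
  let M : Submodule ℝ (Euc n) := (LinearMap.ker P)ᗮ
  let B : M →ₗ[ℝ] LinearMap.ker P :=
    ((P - LinearMap.id) ∘ₗ M.subtype).codRestrict (LinearMap.ker P) (by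
      intro m; simp [hPP])
  obtain ⟨V, hV⟩ := exists_isom_aux B (by rw [hd]; exact h)
  have hBm : ∀ m : M, P m = m + (B m : Euc n) := by 
    intro m
    have : (B m : Euc n) = P m - m := rfl
    rw [this]; abel
  have horth : ∀ (m : M) (k : LinearMap.ker P), inner ℝ (m : Euc n) (k : Euc n) = 0 :=
    fun m k => Submodule.inner_left_of_mem_orthogonal k.2 m.2
  have horth' : ∀ (m : M) (k : LinearMap.ker P), inner ℝ (k : Euc n) (m : Euc n) = 0 :=
    fun m k => Submodule.inner_right_of_mem_orthogonal k.2 m.2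
  have hVV : ∀ m m' : M, inner ℝ (V m : Euc n) (V m' : Euc n) = inner ℝ (m : Euc n) (m' : Euc n) := by
    intro m m'
    exact V.inner_map_map m m'
  let L : M →ₗ[ℝ] Euc n := M.subtype - (LinearMap.ker P).subtype ∘ₗ V.toLinearMap
  have hL : ∀ m, L m = (m : Euc n) - (V m : Euc n) := fun m => rfl
  have hn1 : ∀ m, ‖L m‖ ^ 2 = 2 * ‖m‖ ^ 2 := by
    intro m
    rw [hL, ← real_inner_self_eq_norm_sq, inner_sub_left, inner_sub_right, inner_sub_right,
      horth, horth', hVV, real_inner_self_eq_norm_sq]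
    simp only [Submodule.coe_norm]
    ring
  have hn2 : ∀ m : M, ‖(m : Euc n) + (V m : Euc n)‖ ^ 2 = 2 * ‖m‖ ^ 2 := by
    intro m
    rw [← real_inner_self_eq_norm_sq, inner_add_left, inner_add_right, inner_add_right,
      horth, horth', hVV, real_inner_self_eq_norm_sq]
    simp only [Submodule.coe_norm]
    ring
  have hinj : Function.Injective L := by
    rw [injective_iff_map_eq_zero]
    intro m hm
    have := hn1 m
    rw [hm] at this
    have h3 : ‖m‖ ^ 2 = 0 := by simp at this; simp [this]
    simpa using h3
  refine ⟨LinearMap.range L, ?_, ?_⟩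
  · rw [LinearMap.finrank_range_of_inj hinj, hd]
  · rintro x ⟨m, rfl⟩
    have hw : (m : Euc n) + (V m : Euc n) ∈ (LinearMap.range L)ᗮ := by
      rw [Submodule.mem_orthogonal]
      rintro _ ⟨m', rfl⟩
      rw [hL, inner_sub_left, inner_add_right, inner_add_right, horth, horth', hVV]
      ring
    have hPL : ((2 : ℝ) • P) (L m) = (2 : ℝ) • ((m : Euc n) + (B m : Euc n)) := by
      rw [LinearMap.smul_apply, hL, map_sub, hBm, LinearMap.mem_ker.1 (V m).2, sub_zero]
    have hi := Submodule.inner_orthogonalProjectionOnto_eq_of_mem_right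
      (K := (LinearMap.range L)ᗮ) ⟨_, hw⟩ (((2 : ℝ) • P) (L m))
    have hcs := real_inner_le_norm
      (Submodule.orthogonalProjectionOnto (LinearMap.range L)ᗮ (((2 : ℝ) • P) (L m))) ⟨_, hw⟩
    rw [hi, hPL] at hcs
    have hbv : 0 ≤ inner ℝ (B m : Euc n) (V m : Euc n) := by simpa using hV m
    have hin : inner ℝ ((2 : ℝ) • ((m : Euc n) + (B m : Euc n))) ((m : Euc n) + (V m : Euc n))
        = 2 * (‖m‖ ^ 2 + inner ℝ (B m : Euc n) (V m : Euc n)) := by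
      rw [real_inner_smul_left, inner_add_left, inner_add_right, inner_add_right,
        horth, horth', real_inner_self_eq_norm_sq]
      simp only [Submodule.coe_norm]
      ring
    rw [← hPL] at hcs hin
    simp only [hin] at hcs
    have hnw : ‖(⟨_, hw⟩ : ((LinearMap.range L)ᗮ : Submodule ℝ (Euc n)))‖ = ‖L m‖ := by
      rw [Submodule.coe_norm]
      have := (hn2 m).trans (hn1 m).symm
      exact (sq_eq_sq₀ (norm_nonneg _) (norm_nonneg _)).1 this
    rw [hnw] at hcs
    have h5 := hn1 m
    rw [one_mul]
    by_cases h0 : ‖L m‖ = 0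
    · rw [h0]; positivity
    · have hpos : 0 < ‖L m‖ := lt_of_le_of_ne (norm_nonneg _) (Ne.symm h0)
      refine le_of_mul_le_mul_right ?_ hpos
      nlinarith

theorem statement_17 (n : ℕ) (hn : 2 ≤ n) (P : Euc n →ₗ[ℝ] Euc n) (hP : P ∘ₗ P = P)
    (s : ℕ) (hs : Module.finrank ℝ (LinearMap.range P) = s)
    (hs1 : 1 ≤ s) (hs2 : s ≤ n - 1) :
    IsMixing n ((2 : ℝ) • P) (min s (n - s)) 1 := by
  have hPP : ∀ x, P (P x) = P x := fun x => LinearMap.congr_fun hP x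
  have h2 := P.finrank_range_add_finrank_ker
  have h3 : Module.finrank ℝ (Euc n) = n := by simp
  rcases le_total s (n - s) with hle | hle
  · rw [min_eq_left hle, ← hs]
    exact mixing_aux n P hP (by omega)
  · rw [min_eq_right hle]
    have hr : LinearMap.range (LinearMap.id - P) = LinearMap.ker P := by
      ext x
      constructor
      · rintro ⟨y, rfl⟩
        simp [hPP]
      · intro hx
        exact ⟨x, by simp [LinearMap.mem_ker.1 hx]⟩
    have hk : LinearMap.ker (LinearMap.id - P) = LinearMap.range P := by
      ext x
      constructor
      · intro hx
        have : x - P x = 0 := hx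
        exact ⟨x, (sub_eq_zero.1 this).symm⟩
      · rintro ⟨y, rfl⟩
        simp [hPP]
    obtain ⟨E, hE, hx⟩ := mixing_aux n (LinearMap.id - P)
      (by ext1 x; simp [hPP]) (by rw [hr, hk]; omega)
    refine ⟨E, by rw [hr] at hE; omega, fun x hxE => ?_⟩
    have h := hx x hxE
    have h0 : Submodule.orthogonalProjectionOnto Eᗮ x = 0 :=
      Submodule.orthogonalProjectionOnto_orthogonal_apply_eq_zero hxE
    have e : ((2 : ℝ) • (LinearMap.id - P : Euc n →ₗ[ℝ] Euc n)) x = (2 : ℝ) • x - ((2 : ℝ) • P) x := by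
      simp [smul_sub]
    rwa [e, map_sub, map_smul, h0, smul_zero, zero_sub, norm_neg] at h
end
end

section
/- For every n-dimensional normed space X, bc(X) ≥ inf{ ‖T : X → X‖ : T ∈ Mix_n(⌊n/2⌋, 1/2) }, i.e. the basis constant of X is bounded below by the infimum of the operator norms ‖T : X → X‖ over all (⌊n/2⌋, 1/2)-mixing operators T on ℝⁿ. -/
open MeasureTheory Set
open scoped ENNReal RealInnerProductSpace Pointwise BigOperators

noncomputable section

theorem aux_polar {G H : Type*} [NormedAddCommGroup G] [InnerProductSpace ℝ G]
    [FiniteDimensional ℝ G] [NormedAddCommGroup H] [InnerProductSpace ℝ H]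
    [FiniteDimensional ℝ H] (B : G →ₗ[ℝ] H)
    (h : Module.finrank ℝ G ≤ Module.finrank ℝ H) :
    ∃ U : G →ₗᵢ[ℝ] H, ∀ x, 0 ≤ ⟪U x, B x⟫ := by
  classical
  have hS : (LinearMap.adjoint B ∘ₗ B).IsSymmetric := by
    intro x y
    simp [LinearMap.adjoint_inner_left, LinearMap.adjoint_inner_right]
  let b := hS.eigenvectorBasis rfl
  have hb : ∀ i j, i ≠ j → ⟪B (b i), B (b j)⟫ = 0 := by
    intro i j hij
    have h1 : ⟪(LinearMap.adjoint B ∘ₗ B) (b i), b j⟫ = ⟪B (b i), B (b j)⟫ := by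
      simp [LinearMap.adjoint_inner_left]
    rw [← h1, hS.apply_eigenvectorBasis rfl i, inner_smul_left]
    have : ⟪b i, b j⟫ = 0 := b.orthonormal.2 hij
    change _ * ⟪b i, b j⟫ = 0
    rw [this, mul_zero]
  let v : Fin (Module.finrank ℝ H) → H := fun i =>
    if hi : (i : ℕ) < Module.finrank ℝ G then ‖B (b ⟨i, hi⟩)‖⁻¹ • B (b ⟨i, hi⟩) else 0
  let s : Set (Fin (Module.finrank ℝ H)) :=
    {i | ∃ hi : (i : ℕ) < Module.finrank ℝ G, B (b ⟨i, hi⟩) ≠ 0}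
  have hv : Orthonormal ℝ (s.domRestrict v) := by
    constructor
    · rintro ⟨i, hi, hne⟩
      simp only [Set.domRestrict_apply, v, dif_pos hi]
      rw [norm_smul, norm_inv, norm_norm, inv_mul_cancel₀ (norm_ne_zero_iff.2 hne)]
    · rintro ⟨i, hi, hne⟩ ⟨j, hj, hne'⟩ hij
      simp only [Set.domRestrict_apply, v, dif_pos hi, dif_pos hj]
      rw [inner_smul_left, inner_smul_right, hb, mul_zero, mul_zero]
      intro hh
      apply hij
      simp only [Fin.mk.injEq] at hh
      exact Subtype.ext (Fin.ext hh)
  obtain ⟨f, hf⟩ := hv.exists_orthonormalBasis_extension_of_card_eq (by simp)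
  let g : Fin (Module.finrank ℝ G) → H := fun i => f (Fin.castLE h i)
  have hg : Orthonormal ℝ g := f.orthonormal.comp _ (Fin.castLE_injective h)
  have hBg : ∀ i, B (b i) = ‖B (b i)‖ • g i := by
    intro i
    by_cases h0 : B (b i) = 0
    · simp [h0]
    · have h1 : g i = ‖B (b i)‖⁻¹ • B (b i) := by
        have := hf (Fin.castLE h i) ⟨i.2, h0⟩
        simp only [g]
        rw [this]
        simp [v]
      rw [h1, smul_smul, mul_inv_cancel₀ (norm_ne_zero_iff.2 h0), one_smul]
  let L : G →ₗ[ℝ] H := b.toBasis.constr ℝ g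
  have hL : ∀ i, L (b i) = g i := by
    intro i
    have := b.toBasis.constr_basis ℝ g i
    simpa [L] using this
  have hLb : Orthonormal ℝ (L ∘ b.toBasis) := by
    have : (L ∘ b.toBasis) = g := by
      ext1 i
      simpa using hL i
    rw [this]; exact hg
  let U := L.isometryOfOrthonormal (v := b.toBasis) (by simpa using b.orthonormal) hLb
  refine ⟨U, fun x => ?_⟩
  have hU : U x = L x := rfl
  have h1 : L x = ∑ i, b.repr x i • g i := by
    conv_lhs => rw [← b.sum_repr x]
    simp [map_sum, hL]
  have h2 : B x = ∑ i, (b.repr x i * ‖B (b i)‖) • g i := by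
    conv_lhs => rw [← b.sum_repr x]
    rw [map_sum]
    refine Finset.sum_congr rfl fun i _ => ?_
    rw [map_smul, mul_smul, ← hBg]
  rw [hU, h1, h2, hg.inner_sum]
  refine Finset.sum_nonneg fun i _ => ?_
  simp only [conj_trivial]
  nlinarith [mul_nonneg (mul_self_nonneg (b.repr x i)) (norm_nonneg (B (b i)))]

theorem aux_mixing (n : ℕ) (G : Submodule ℝ (Euc n)) (hG : 2 * Module.finrank ℝ G ≤ n)
    (P : Euc n →ₗ[ℝ] Euc n) (hP : ∀ x, P x ∈ G) (hPG : ∀ x ∈ G, P x = x) :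
    IsMixing n P (Module.finrank ℝ G) (1 / 2) := by
  let A : Gᗮ →ₗ[ℝ] G := (P.codRestrict G hP) ∘ₗ Gᗮ.subtype
  have hdim : Module.finrank ℝ G ≤ Module.finrank ℝ Gᗮ := by
    have := G.finrank_add_finrank_orthogonal
    rw [finrank_euclideanSpace_fin] at this
    omega
  obtain ⟨U, hU⟩ := aux_polar (LinearMap.adjoint A) hdim
  let J : G →ₗ[ℝ] Euc n := G.subtype + Gᗮ.subtype ∘ₗ U.toLinearMap
  have hJ : ∀ x, J x = (x : Euc n) + (U x : Euc n) := fun x => rfl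
  have horth : ∀ x y : G, ⟪(x : Euc n), (U y : Euc n)⟫ = 0 := fun x y =>
    Submodule.inner_right_of_mem_orthogonal x.2 (U y).2
  have horth' : ∀ x y : G, ⟪(U x : Euc n), (y : Euc n)⟫ = 0 := fun x y =>
    Submodule.inner_left_of_mem_orthogonal y.2 (U x).2
  have hUU : ∀ x y : G, ⟪(U x : Euc n), (U y : Euc n)⟫ = ⟪(x : Euc n), (y : Euc n)⟫ := by
    intro x y
    exact U.inner_map_map x y
  have hnJ : ∀ x, ‖J x‖ ^ 2 = 2 * ‖x‖ ^ 2 := by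
    intro x
    rw [← real_inner_self_eq_norm_sq, ← real_inner_self_eq_norm_sq, hJ, inner_add_left,
      inner_add_right, inner_add_right, horth, horth', hUU, Submodule.coe_inner]
    ring
  have hinj : Function.Injective J := by
    rw [injective_iff_map_eq_zero]
    intro x hx
    have := hnJ x
    rw [hx] at this
    have h0 : ‖x‖ ^ 2 = 0 := by
      rw [norm_zero] at this; linarith
    simpa using h0
  refine ⟨LinearMap.range J, (LinearMap.finrank_range_of_inj hinj).ge, ?_⟩
  rintro _ ⟨x, rfl⟩
  set E := LinearMap.range J
  let y : G := x + A (U x)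
  have hy : P (J x) = y := by
    rw [hJ, map_add, hPG _ x.2]; rfl
  let q : Euc n := (1 / 2 : ℝ) • ((y : Euc n) - (U y : Euc n))
  have hq : q ∈ Eᗮ := by
    rw [Submodule.mem_orthogonal]
    rintro _ ⟨z, rfl⟩
    rw [hJ, inner_smul_right, inner_add_left, inner_sub_right, inner_sub_right, horth, horth', hUU]
    ring
  have hp : (1 / 2 : ℝ) • J y ∈ Eᗮᗮ :=
    Submodule.le_orthogonal_orthogonal _ (E.smul_mem _ ⟨y, rfl⟩)
  have hdec : P (J x) = (1 / 2 : ℝ) • J y + q := by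
    rw [hy, hJ]
    simp only [q]
    module
  have hproj : Submodule.orthogonalProjectionOnto Eᗮ (P (J x)) = ⟨q, hq⟩ := by
    rw [hdec, map_add, Submodule.orthogonalProjectionOnto_eq_zero_iff.2 hp,
      zero_add]
    exact Submodule.orthogonalProjectionOnto_mem_subspace_eq_self (⟨q, hq⟩ : Eᗮ)
  rw [hproj, Submodule.coe_norm]
  have hqn : ‖q‖ ^ 2 = 1 / 2 * ‖y‖ ^ 2 := by
    rw [← real_inner_self_eq_norm_sq, ← real_inner_self_eq_norm_sq, inner_smul_left,
      inner_smul_right, inner_sub_left,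
      inner_sub_right, inner_sub_right, horth, horth', hUU, Submodule.coe_inner]
    simp only [conj_trivial]
    ring
  have hxy : ‖x‖ ≤ ‖y‖ := by
    have h1 : ‖x‖ ^ 2 ≤ ⟪y, x⟫ := by
      have h2 : 0 ≤ ⟪A (U x), x⟫ := by
        have := hU x
        rwa [LinearMap.adjoint_inner_right] at this
      rw [inner_add_left, real_inner_self_eq_norm_sq]
      linarith
    have h3 := real_inner_le_norm y x
    by_contra hlt
    push Not at hlt
    nlinarith [norm_nonneg y, norm_nonneg x]
  refine le_of_sq_le_sq ?_ (norm_nonneg q)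
  have := hnJ x
  have h4 : ‖x‖ ^ 2 ≤ ‖y‖ ^ 2 := pow_le_pow_left₀ (norm_nonneg _) hxy 2
  rw [mul_pow, this, hqn]
  linarith

theorem aux_nonempty_s18 (n : ℕ) (K : Set (Euc n)) (hK : IsSymmConvexBody n K) :
    {c : ℝ | 0 < c ∧ ∃ b : Module.Basis (Fin n) ℝ (Euc n),
    ∀ k : ℕ, k ≤ n → ∀ lam : Fin n → ℝ,
      gauge K (∑ i ∈ Finset.univ.filter (fun i : Fin n => (i : ℕ) < k), lam i • b i) ≤
        c * gauge K (∑ i, lam i • b i)}.Nonempty := by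
  obtain ⟨hc, hs, hcomp, h0⟩ := hK
  obtain ⟨r, hr, hrK⟩ := Metric.mem_nhds_iff.1 (mem_interior_iff_mem_nhds.1 h0)
  obtain ⟨R, hR, hRK⟩ := hcomp.isBounded.subset_closedBall_lt 0 (0 : Euc n)
  have hab : Absorbent ℝ K := absorbent_nhds_zero (mem_interior_iff_mem_nhds.1 h0)
  refine ⟨R / r, by positivity, (EuclideanSpace.basisFun (Fin n) ℝ).toBasis, ?_⟩
  intro k hk lam
  simp only [OrthonormalBasis.coe_toBasis]
  set e := EuclideanSpace.basisFun (Fin n) ℝ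
  have hn : ∀ s : Finset (Fin n), ‖∑ i ∈ s, lam i • e i‖ ^ 2 = ∑ i ∈ s, lam i ^ 2 := by
    intro s
    rw [← real_inner_self_eq_norm_sq, e.orthonormal.inner_sum]
    refine Finset.sum_congr rfl fun i _ => ?_
    simp only [conj_trivial]; ring
  set u := ∑ i ∈ Finset.univ.filter (fun i : Fin n => (i : ℕ) < k), lam i • e i with hu
  set w := ∑ i, lam i • e i with hw
  have huw : ‖u‖ ≤ ‖w‖ := by
    refine le_of_sq_le_sq ?_ (norm_nonneg _)
    rw [hu, hw, hn, hn]
    exact Finset.sum_le_sum_of_subset_of_nonneg (Finset.filter_subset _ _)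
      fun i _ _ => sq_nonneg _
  have h1 : r * gauge K u ≤ ‖u‖ := mul_gauge_le_norm hrK
  have h2 : ‖w‖ / R ≤ gauge K w := le_gauge_of_subset_closedBall hab hR.le hRK
  rw [div_le_iff₀ hR] at h2
  rw [div_mul_eq_mul_div, le_div_iff₀ hr]
  linarith

theorem statement_18 (n : ℕ) (K : Set (Euc n)) (hK : IsSymmConvexBody n K) :
    sInf ((fun T => bodyOpNorm n K K T) '' {T | IsMixing n T (n / 2) (1 / 2)}) ≤
      basisConstant n K := by
  classical
  refine le_csInf (aux_nonempty_s18 n K hK) ?_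
  rintro c ⟨hc, b, hb⟩
  obtain ⟨-, -, -, h0⟩ := hK
  let k := n / 2
  have hkn : k ≤ n := Nat.div_le_self n 2
  let P : Euc n →ₗ[ℝ] Euc n := b.constr ℝ fun i => if (i : ℕ) < k then b i else 0
  have hPb : ∀ i, P (b i) = if (i : ℕ) < k then b i else 0 := fun i => b.constr_basis ℝ _ i
  have hPx : ∀ x, P x =
      ∑ i ∈ Finset.univ.filter (fun i : Fin n => (i : ℕ) < k), b.repr x i • b i := by
    intro x
    conv_lhs => rw [← b.sum_repr x]
    rw [map_sum, Finset.sum_filter]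
    refine Finset.sum_congr rfl fun i _ => ?_
    rw [map_smul, hPb]
    split_ifs <;> simp
  let g : Fin k → Euc n := fun i => b (Fin.castLE hkn i)
  have hg : LinearIndependent ℝ g := b.linearIndependent.comp _ (Fin.castLE_injective hkn)
  let G : Submodule ℝ (Euc n) := Submodule.span ℝ (Set.range g)
  have hGk : Module.finrank ℝ G = k := by
    have := finrank_span_eq_card hg
    simpa using this
  have hmix : IsMixing n P (n / 2) (1 / 2) := by
    have := aux_mixing n G (by rw [hGk]; omega) P ?_ ?_
    · rwa [hGk] at this
    · intro x
      rw [hPx]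
      refine Submodule.sum_mem _ fun i hi => Submodule.smul_mem _ _ ?_
      rw [Finset.mem_filter] at hi
      exact Submodule.subset_span ⟨⟨i, hi.2⟩, rfl⟩
    · intro x hx
      induction hx using Submodule.span_induction with
      | mem x h =>
        obtain ⟨i, rfl⟩ := h
        simp only [g]
        rw [hPb, if_pos]
        exact i.2
      | zero => simp
      | add x y _ _ hx hy => rw [map_add, hx, hy]
      | smul a x _ hx => rw [map_smul, hx]
  have hle : bodyOpNorm n K K P ≤ c := by
    refine csSup_le (Set.Nonempty.image _ ⟨0, interior_subset h0⟩) ?_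
    rintro _ ⟨x, hx, rfl⟩
    have h1 := hb k hkn (fun i => b.repr x i)
    rw [← hPx, b.sum_repr] at h1
    have h2 : gauge K x ≤ 1 := gauge_le_one_of_mem hx
    calc gauge K (P x) ≤ c * gauge K x := h1
      _ ≤ c * 1 := by gcongr
      _ = c := mul_one c
  refine le_trans (csInf_le ⟨0, ?_⟩ (Set.mem_image_of_mem _ (show P ∈ {T | IsMixing n T (n / 2) (1 / 2)} from hmix))) hle
  rintro _ ⟨T, -, rfl⟩
  refine Real.sSup_nonneg ?_
  rintro _ ⟨x, -, rfl⟩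
  exact gauge_nonneg _

end
end
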